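/- arXiv:2601.18039 — 2 statements merged into one kernel-verified Lean document; each statement's English description precedes it below -/
import Mathlib

section
/- Let K be a field and define ρ : (x,y,z) ↦ (yz/(x+z), x+z, xy/(x+z)) wherever x + z ≠ 0. For a 6-tuple t ∈ K⁶ and positions (p, p+1, p+2), let ρ_{(p,p+1,p+2)} apply ρ to the entries (t_p, t_{p+1}, t_{p+2}) leaving the others fixed, and let L(k) swap entries t_k and t_{k+1}. Let a₁, …, a₆ ∈ K satisfy a₄ + a₆ ≠ 0, a₁ + a₄ ≠ 0, β := a₁ + a₄ + a₆ ≠ 0, δ := a₂a₄ + a₂a₆ + a₅a₆ ≠ 0, ε := a₁a₂ + a₁a₅ + a₄a₅ ≠ 0. Then the two compositions U := L(3) ∘ ρ_{(4,5,6)} ∘ ρ_{(2,3,4)} ∘ L(1) ∘ L(4) ∘ ρ_{(2,3,4)} ∘ ρ_{(4,5,6)} and V := ρ_{(1,2,3)} ∘ ρ_{(3,4,5)} ∘ L(5) ∘ L(2) ∘ ρ_{(3,4,5)} ∘ ρ_{(1,2,3)} ∘ L(3), applied to (a₁, a₂, a₃, a₄, a₅, a₆), give the same result, namely (a₃a₅a₆/δ,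 δ/β, a₂a₃a₄a₅β/(εδ), β, ε/β, a₁a₂a₃/ε). -/
/-- The Lusztig map `ρ(x,y,z) = (yz/(x+z), x+z, xy/(x+z))`. -/
def lusztigR {K : Type*} [Field K] (p : K × K × K) : K × K × K :=
  (p.2.1 * p.2.2 / (p.1 + p.2.2), p.1 + p.2.2, p.1 * p.2.1 / (p.1 + p.2.2))

/-- Apply `ρ` to positions `k, k+1, k+2` (0-based `k`) of a 6-tuple. -/
def Rmv {K : Type*} [Field K] (k : Fin 6) (t : Fin 6 → K) : Fin 6 → K :=
  fun m =>
    if m = k then (lusztigR (t k, t (k + 1), t (k + 2))).1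
    else if m = k + 1 then (lusztigR (t k, t (k + 1), t (k + 2))).2.1
    else if m = k + 2 then (lusztigR (t k, t (k + 1), t (k + 2))).2.2
    else t m

/-- `L(k)`: swap the entries in positions `k` and `k+1` (0-based `k`). -/
def Lmv {K : Type*} [Field K] (k : Fin 6) (t : Fin 6 → K) : Fin 6 → K :=
  fun m => if m = k then t (k + 1) else if m = k + 1 then t k else t m

theorem Rmv_zero_vec {K : Type*} [Field K] (a b c d e f : K) :
    Rmv 0 ![a, b, c, d, e, f] = ![b * c / (a + c), a + c, a * b / (a + c), d, e, f] := by
  funext i; fin_cases i <;> rfl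

theorem Rmv_one_vec {K : Type*} [Field K] (a b c d e f : K) :
    Rmv 1 ![a, b, c, d, e, f] = ![a, c * d / (b + d), b + d, b * c / (b + d), e, f] := by
  funext i; fin_cases i <;> rfl

theorem Rmv_two_vec {K : Type*} [Field K] (a b c d e f : K) :
    Rmv 2 ![a, b, c, d, e, f] = ![a, b, d * e / (c + e), c + e, c * d / (c + e), f] := by
  funext i; fin_cases i <;> rfl

theorem Rmv_three_vec {K : Type*} [Field K] (a b c d e f : K) :
    Rmv 3 ![a, b, c, d, e, f] = ![a, b, c, e * f / (d + f), d + f, d * e / (d + f)] := by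
  funext i; fin_cases i <;> rfl

theorem Lmv_zero_vec {K : Type*} [Field K] (a b c d e f : K) :
    Lmv 0 ![a, b, c, d, e, f] = ![b, a, c, d, e, f] := by
  funext i; fin_cases i <;> rfl

theorem Lmv_one_vec {K : Type*} [Field K] (a b c d e f : K) :
    Lmv 1 ![a, b, c, d, e, f] = ![a, c, b, d, e, f] := by
  funext i; fin_cases i <;> rfl

theorem Lmv_two_vec {K : Type*} [Field K] (a b c d e f : K) :
    Lmv 2 ![a, b, c, d, e, f] = ![a, b, d, c, e, f] := by
  funext i; fin_cases i <;> rfl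

theorem Lmv_three_vec {K : Type*} [Field K] (a b c d e f : K) :
    Lmv 3 ![a, b, c, d, e, f] = ![a, b, c, e, d, f] := by
  funext i; fin_cases i <;> rfl

theorem Lmv_four_vec {K : Type*} [Field K] (a b c d e f : K) :
    Lmv 4 ![a, b, c, d, e, f] = ![a, b, c, d, f, e] := by
  funext i; fin_cases i <;> rfl

/-- The sonnet (tetrahedron) equation for the idempotent `R`-matrix: the compositions
`U = L(3)∘ρ₍₄₅₆₎∘ρ₍₂₃₄₎∘L(1)∘L(4)∘ρ₍₂₃₄₎∘ρ₍₄₅₆₎` and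
`V = ρ₍₁₂₃₎∘ρ₍₃₄₅₎∘L(5)∘L(2)∘ρ₍₃₄₅₎∘ρ₍₁₂₃₎∘L(3)` agree on `(a₁,…,a₆)`, with common value
`(a₃a₅a₆/δ, δ/β, a₂a₃a₄a₅β/(εδ), β, ε/β, a₁a₂a₃/ε)`.
(Moves are written with 0-based positions.) -/
theorem sonnet_idempotent_R {K : Type*} [Field K] (a₁ a₂ a₃ a₄ a₅ a₆ : K)
    (h46 : a₄ + a₆ ≠ 0) (h14 : a₁ + a₄ ≠ 0)
    (hβ : a₁ + a₄ + a₆ ≠ 0)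
    (hδ : a₂ * a₄ + a₂ * a₆ + a₅ * a₆ ≠ 0)
    (hε : a₁ * a₂ + a₁ * a₅ + a₄ * a₅ ≠ 0) :
    Lmv 2 (Rmv 3 (Rmv 1 (Lmv 0 (Lmv 3 (Rmv 1 (Rmv 3 ![a₁, a₂, a₃, a₄, a₅, a₆])))))) =
        ![a₃ * a₅ * a₆ / (a₂ * a₄ + a₂ * a₆ + a₅ * a₆),
          (a₂ * a₄ + a₂ * a₆ + a₅ * a₆) / (a₁ + a₄ + a₆),
          a₂ * a₃ * a₄ * a₅ * (a₁ + a₄ + a₆) /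
            ((a₁ * a₂ + a₁ * a₅ + a₄ * a₅) * (a₂ * a₄ + a₂ * a₆ + a₅ * a₆)),
          a₁ + a₄ + a₆,
          (a₁ * a₂ + a₁ * a₅ + a₄ * a₅) / (a₁ + a₄ + a₆),
          a₁ * a₂ * a₃ / (a₁ * a₂ + a₁ * a₅ + a₄ * a₅)] ∧
    Rmv 0 (Rmv 2 (Lmv 4 (Lmv 1 (Rmv 2 (Rmv 0 (Lmv 2 ![a₁, a₂, a₃, a₄, a₅, a₆])))))) =
        ![a₃ * a₅ * a₆ / (a₂ * a₄ + a₂ * a₆ + a₅ * a₆),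
          (a₂ * a₄ + a₂ * a₆ + a₅ * a₆) / (a₁ + a₄ + a₆),
          a₂ * a₃ * a₄ * a₅ * (a₁ + a₄ + a₆) /
            ((a₁ * a₂ + a₁ * a₅ + a₄ * a₅) * (a₂ * a₄ + a₂ * a₆ + a₅ * a₆)),
          a₁ + a₄ + a₆,
          (a₁ * a₂ + a₁ * a₅ + a₄ * a₅) / (a₁ + a₄ + a₆),
          a₁ * a₂ * a₃ / (a₁ * a₂ + a₁ * a₅ + a₄ * a₅)] := by
  have hβ' : a₁ + (a₄ + a₆) = a₁ + a₄ + a₆ := by ring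
  have hδ' : a₂ + a₅ * a₆ / (a₄ + a₆) =
      (a₂ * a₄ + a₂ * a₆ + a₅ * a₆) / (a₄ + a₆) := by
    field_simp
  have hε' : a₁ * a₂ / (a₁ + a₄) + a₅ =
      (a₁ * a₂ + a₁ * a₅ + a₄ * a₅) / (a₁ + a₄) := by
    field_simp; ring
  have hU : a₁ * ((a₂ * a₄ + a₂ * a₆ + a₅ * a₆) / (a₄ + a₆)) / (a₁ + a₄ + a₆) +
      a₄ * a₅ / (a₄ + a₆) =
      (a₁ * a₂ + a₁ * a₅ + a₄ * a₅) / (a₁ + a₄ + a₆) := by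
    field_simp; ring
  have hV : a₂ * a₄ / (a₁ + a₄) +
      (a₁ * a₂ + a₁ * a₅ + a₄ * a₅) / (a₁ + a₄) * a₆ / (a₁ + a₄ + a₆) =
      (a₂ * a₄ + a₂ * a₆ + a₅ * a₆) / (a₁ + a₄ + a₆) := by
    field_simp; ring
  constructor
  · rw [Rmv_three_vec, Rmv_one_vec, hδ', Lmv_three_vec, Lmv_zero_vec, Rmv_one_vec, hβ',
      Rmv_three_vec, hU, Lmv_two_vec]
    generalize a₂ * a₄ + a₂ * a₆ + a₅ * a₆ = δ at hδ ⊢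
    generalize a₁ * a₂ + a₁ * a₅ + a₄ * a₅ = ε at hε ⊢
    simp only [Matrix.vecCons_inj, and_true, true_and]
    refine ⟨?_, ?_, ?_, ?_⟩ <;> field_simp
  · rw [Lmv_two_vec, Rmv_zero_vec, Rmv_two_vec, hε', Lmv_one_vec, Lmv_four_vec, Rmv_two_vec,
      Rmv_zero_vec, hV]
    generalize a₂ * a₄ + a₂ * a₆ + a₅ * a₆ = δ at hδ ⊢
    generalize a₁ * a₂ + a₁ * a₅ + a₄ * a₅ = ε at hε ⊢
    simp only [Matrix.vecCons_inj, and_true, true_and]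
    refine ⟨?_, ?_, ?_, ?_⟩ <;> field_simp
end

section
/- Let K be a field and define the Lusztig map ρ : (x,y,z) ↦ (yz/(x+z), x+z, xy/(x+z)) wherever x + z ≠ 0. For 1 ≤ k ≤ 4 let R(k) : K⁶ ⇢ K⁶ apply ρ to the entries (t_k, t_{k+1}, t_{k+2}) of a 6-tuple t, and for 1 ≤ k ≤ 5 let L(k) swap entries t_k and t_{k+1}. Let a₁, …, a₆ ∈ K satisfy α := a₁ + a₃ ≠ 0, γ := a₃ + a₆ ≠ 0, β := a₁ + a₃ + a₆ ≠ 0, δ := a₂a₃ + a₂a₆ + a₅a₆ ≠ 0, ε := a₁a₂ + a₁a₅ + a₃a₅ ≠ 0. Then the compositions R(1)∘R(3)∘L(5)∘L(2)∘R(3)∘R(1)∘L(3) and L(3)∘R(4)∘R(2)∘L(4)∘L(1)∘R(2)∘R(4), applied to the tuple (a₆, a₅, a₄, a₃, a₂, a₁), give the same result, namely (a₁a₂a₄/ε, ε/β, a₂a₃a₄a₅β/(δε), β, δ/β, a₄a₅a₆/δ). -/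
/-- The tetrahedron (sonnet) equation for the Lusztig flip: the compositions
`R(1)∘R(3)∘L(5)∘L(2)∘R(3)∘R(1)∘L(3)` and `L(3)∘R(4)∘R(2)∘L(4)∘L(1)∘R(2)∘R(4)` applied to
`(a₆,a₅,a₄,a₃,a₂,a₁)` give the same result
`(a₁a₂a₄/ε, ε/β, a₂a₃a₄a₅β/(δε), β, δ/β, a₄a₅a₆/δ)`.
(Moves are written with 0-based positions.) -/
theorem sonnet_lusztig_flip {K : Type*} [Field K] (a₁ a₂ a₃ a₄ a₅ a₆ : K)
    (hα : a₁ + a₃ ≠ 0) (hγ : a₃ + a₆ ≠ 0) (hβ : a₁ + a₃ + a₆ ≠ 0)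
    (hδ : a₂ * a₃ + a₂ * a₆ + a₅ * a₆ ≠ 0)
    (hε : a₁ * a₂ + a₁ * a₅ + a₃ * a₅ ≠ 0) :
    Rmv 0 (Rmv 2 (Lmv 4 (Lmv 1 (Rmv 2 (Rmv 0 (Lmv 2 ![a₆, a₅, a₄, a₃, a₂, a₁])))))) =
        ![a₁ * a₂ * a₄ / (a₁ * a₂ + a₁ * a₅ + a₃ * a₅),
          (a₁ * a₂ + a₁ * a₅ + a₃ * a₅) / (a₁ + a₃ + a₆),
          a₂ * a₃ * a₄ * a₅ * (a₁ + a₃ + a₆) /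
            ((a₂ * a₃ + a₂ * a₆ + a₅ * a₆) * (a₁ * a₂ + a₁ * a₅ + a₃ * a₅)),
          a₁ + a₃ + a₆,
          (a₂ * a₃ + a₂ * a₆ + a₅ * a₆) / (a₁ + a₃ + a₆),
          a₄ * a₅ * a₆ / (a₂ * a₃ + a₂ * a₆ + a₅ * a₆)] ∧
    Lmv 2 (Rmv 3 (Rmv 1 (Lmv 3 (Lmv 0 (Rmv 1 (Rmv 3 ![a₆, a₅, a₄, a₃, a₂, a₁])))))) =
        ![a₁ * a₂ * a₄ / (a₁ * a₂ + a₁ * a₅ + a₃ * a₅),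
          (a₁ * a₂ + a₁ * a₅ + a₃ * a₅) / (a₁ + a₃ + a₆),
          a₂ * a₃ * a₄ * a₅ * (a₁ + a₃ + a₆) /
            ((a₂ * a₃ + a₂ * a₆ + a₅ * a₆) * (a₁ * a₂ + a₁ * a₅ + a₃ * a₅)),
          a₁ + a₃ + a₆,
          (a₂ * a₃ + a₂ * a₆ + a₅ * a₆) / (a₁ + a₃ + a₆),
          a₄ * a₅ * a₆ / (a₂ * a₃ + a₂ * a₆ + a₅ * a₆)] := by
  have hγ' : a₆ + a₃ ≠ 0 := by rwa [add_comm]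
  have hα' : a₃ + a₁ ≠ 0 := by rwa [add_comm]
  constructor
  · have h₁ : a₆ * a₅ / (a₆ + a₃) + a₂ =
        (a₂ * a₃ + a₂ * a₆ + a₅ * a₆) / (a₆ + a₃) := by
      field_simp
      ring
    have h₂ : a₆ + a₃ + a₁ = a₁ + a₃ + a₆ := by ring
    have h₃ : a₅ * a₃ / (a₆ + a₃) +
        (a₂ * a₃ + a₂ * a₆ + a₅ * a₆) / (a₆ + a₃) * a₁ / (a₁ + a₃ + a₆) =
        (a₁ * a₂ + a₁ * a₅ + a₃ * a₅) / (a₁ + a₃ + a₆) := by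
      field_simp
      ring
    rw [Lmv_two_vec, Rmv_zero_vec, Rmv_two_vec, Lmv_one_vec, Lmv_four_vec, Rmv_two_vec,
      Rmv_zero_vec, h₁, h₂, h₃]
    clear h₁ h₂ h₃
    generalize a₂ * a₃ + a₂ * a₆ + a₅ * a₆ = δ at *
    generalize a₁ * a₂ + a₁ * a₅ + a₃ * a₅ = ε at *
    ext m
    fin_cases m <;> simp only [Fin.zero_eta, Fin.mk_one, Fin.reduceFinMk, Matrix.cons_val] <;>
      field_simp
  · have h₁ : a₅ + a₂ * a₁ / (a₃ + a₁) =
        (a₁ * a₂ + a₁ * a₅ + a₃ * a₅) / (a₃ + a₁) := by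
      field_simp
      ring
    have h₂ : a₆ + (a₃ + a₁) = a₁ + a₃ + a₆ := by ring
    have h₃ : a₆ * ((a₁ * a₂ + a₁ * a₅ + a₃ * a₅) / (a₃ + a₁)) / (a₁ + a₃ + a₆) +
        a₃ * a₂ / (a₃ + a₁) =
        (a₂ * a₃ + a₂ * a₆ + a₅ * a₆) / (a₁ + a₃ + a₆) := by
      field_simp
      ring
    rw [Rmv_three_vec, Rmv_one_vec, Lmv_zero_vec, Lmv_three_vec, Rmv_one_vec, Rmv_three_vec,
      Lmv_two_vec, h₁, h₂, h₃]
    clear h₁ h₂ h₃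
    generalize a₂ * a₃ + a₂ * a₆ + a₅ * a₆ = δ at *
    generalize a₁ * a₂ + a₁ * a₅ + a₃ * a₅ = ε at *
    ext m
    fin_cases m <;> simp only [Fin.zero_eta, Fin.mk_one, Fin.reduceFinMk, Matrix.cons_val] <;>
      field_simp
end
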